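/- Let a = (a₁,a₂,a₃) and b = (b₁,b₂,b₃) be points of [0,π]³ with a₁+a₂+a₃ = π = b₁+b₂+b₃, with a ≠ b, and with every aᵢ in the open interval (0,π). Define V(x) = Λ(x₁)+Λ(x₂)+Λ(x₃). Then V((a+b)/2) > (V(a)+V(b))/2. -/

import Mathlib

open Real

/-- The Lobachevsky function `Λ(x) = -∫₀ˣ log |2 sin t| dt`. -/
noncomputable def lob (x : ℝ) : ℝ := -∫ t in (0:ℝ)..x, Real.log |2 * Real.sin t|

theorem intervalIntegrable_log_abs_two_mul_sin (a b : ℝ) :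
    IntervalIntegrable (fun t => Real.log |2 * Real.sin t|) MeasureTheory.volume a b := by
  have h : MeromorphicOn (fun t : ℝ => 2 * Real.sin t) (Set.uIcc a b) := by
    intro x _
    have : AnalyticAt ℝ (fun t : ℝ => 2 * Real.sin t) x := by fun_prop
    exact this.meromorphicAt
  exact h.intervalIntegrable_log_norm

theorem continuous_lob : Continuous lob :=
  (intervalIntegral.continuous_primitive intervalIntegrable_log_abs_two_mul_sin 0).neg

theorem hasDerivAt_lob {x : ℝ} (hx : x ∈ Set.Ioo 0 π) :
    HasDerivAt lob (-Real.log (2 * Real.sin x)) x := by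
  have hs : 0 < 2 * Real.sin x := mul_pos two_pos (Real.sin_pos_of_mem_Ioo hx)
  have hmeas : Measurable (fun t => Real.log |2 * Real.sin t|) :=
    Real.measurable_log.comp
      ((measurable_const.mul Real.measurable_sin).abs)
  have hcont : ContinuousAt (fun t => Real.log |2 * Real.sin t|) x :=
    ContinuousAt.log (by fun_prop) (abs_pos.mpr hs.ne').ne'
  have h := intervalIntegral.integral_hasDerivAt_right
    (intervalIntegrable_log_abs_two_mul_sin 0 x)
    hmeas.stronglyMeasurable.stronglyMeasurableAtFilter hcont
  rw [abs_of_pos hs] at h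
  exact h.neg

theorem hasDerivAt_log_two_mul_sin {x : ℝ} (hx : x ∈ Set.Ioo 0 π) :
    HasDerivAt (fun t => Real.log (2 * Real.sin t)) (Real.cos x / Real.sin x) x := by
  have hs : 0 < Real.sin x := Real.sin_pos_of_mem_Ioo hx
  convert ((Real.hasDerivAt_sin x).const_mul 2).log (mul_pos two_pos hs).ne' using 1
  field_simp

/-- The quadratic form with the cotangents of the angles of a triangle as coefficients is
positive definite on the plane of vectors with vanishing coordinate sum. -/
theorem sum_sq_mul_cot_pos {x y z u v w : ℝ} (hx : x ∈ Set.Ioo 0 π) (hy : y ∈ Set.Ioo 0 π)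
    (hz : z ∈ Set.Ioo 0 π) (hsum : x + y + z = π) (huvw : u + v + w = 0)
    (hne : u ≠ 0 ∨ v ≠ 0) :
    0 < u ^ 2 * (Real.cos x / Real.sin x) + v ^ 2 * (Real.cos y / Real.sin y) +
      w ^ 2 * (Real.cos z / Real.sin z) := by
  have hsx : 0 < Real.sin x := Real.sin_pos_of_mem_Ioo hx
  have hsy : 0 < Real.sin y := Real.sin_pos_of_mem_Ioo hy
  have hsz : 0 < Real.sin z := Real.sin_pos_of_mem_Ioo hz
  have hcos : Real.cos z = Real.sin x * Real.sin y - Real.cos x * Real.cos y := by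
    rw [show z = π - (x + y) by linarith, Real.cos_pi_sub, Real.cos_add]; ring
  have hsin : Real.sin z = Real.sin x * Real.cos y + Real.cos x * Real.sin y := by
    rw [show z = π - (x + y) by linarith, Real.sin_pi_sub, Real.sin_add]
  have hsin' : Real.sin y = Real.sin x * Real.cos z + Real.cos x * Real.sin z := by
    rw [show y = π - (x + z) by linarith, Real.sin_pi_sub, Real.sin_add]
  set A := Real.cos x / Real.sin x with hA
  set B := Real.cos y / Real.sin y with hB
  set C := Real.cos z / Real.sin z with hC
  have hAC : 0 < A + C := by
    have : A + C = Real.sin y / (Real.sin x * Real.sin z) := by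
      rw [hA, hC, hsin']; field_simp; ring
    rw [this]; positivity
  have hABC : A * B + B * C + C * A = 1 := by
    have h1 : C * (A + B) = 1 - A * B := by
      have : A + B = Real.sin z / (Real.sin x * Real.sin y) := by
        rw [hA, hB, hsin]; field_simp; ring
      rw [this, hC, hA, hB]; field_simp; rw [hcos]
    linarith
  have hw : w = -(u + v) := by linarith
  have key : (A + C) * (u ^ 2 * A + v ^ 2 * B + w ^ 2 * C) =
      ((A + C) * u + C * v) ^ 2 + v ^ 2 := by
    rw [hw]; linear_combination v ^ 2 * hABC
  refine pos_of_mul_pos_right (a := A + C) ?_ hAC.le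
  rw [key]
  by_cases hv : v = 0
  · have hu : u ≠ 0 := by tauto
    have := sq_pos_of_pos hAC
    have := sq_pos_of_ne_zero hu
    rw [hv, mul_zero, add_zero, mul_pow]
    positivity
  · positivity

theorem lineMap_mem_Ioo {a b t c d : ℝ} (ha : a ∈ Set.Ioo c d) (hb : b ∈ Set.Icc c d)
    (ht : t ∈ Set.Ioo (0 : ℝ) 1) : a + t * (b - a) ∈ Set.Ioo c d := by
  obtain ⟨ht0, ht1⟩ := ht
  constructor
  · nlinarith [mul_pos (sub_pos.2 ht1) (sub_pos.2 ha.1), mul_nonneg ht0.le (sub_nonneg.2 hb.1)]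
  · nlinarith [mul_pos (sub_pos.2 ht1) (sub_pos.2 ha.2), mul_nonneg ht0.le (sub_nonneg.2 hb.2)]

theorem hasDerivAt_comp_line {f : ℝ → ℝ} {f' a d t : ℝ} (h : HasDerivAt f f' (a + t * d)) :
    HasDerivAt (fun s => f (a + s * d)) (f' * d) t := by
  have hline : HasDerivAt (fun s => a + s * d) d t := by
    simpa using ((hasDerivAt_id t).mul_const d).const_add a
  exact h.comp t hline

/-- If `a ≠ b` are angle triples in `[0,π]³` each summing to `π`, with `a` having all
entries in `(0,π)`, then the volume of the midpoint triple strictly exceeds the average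
of the volumes. -/
theorem volume_midpoint_gt_average (a₁ a₂ a₃ b₁ b₂ b₃ : ℝ)
    (ha₁ : a₁ ∈ Set.Ioo 0 π) (ha₂ : a₂ ∈ Set.Ioo 0 π) (ha₃ : a₃ ∈ Set.Ioo 0 π)
    (hb₁ : b₁ ∈ Set.Icc 0 π) (hb₂ : b₂ ∈ Set.Icc 0 π) (hb₃ : b₃ ∈ Set.Icc 0 π)
    (hasum : a₁ + a₂ + a₃ = π) (hbsum : b₁ + b₂ + b₃ = π)
    (hne : (a₁, a₂, a₃) ≠ (b₁, b₂, b₃)) :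
    lob ((a₁ + b₁) / 2) + lob ((a₂ + b₂) / 2) + lob ((a₃ + b₃) / 2) >
      ((lob a₁ + lob a₂ + lob a₃) + (lob b₁ + lob b₂ + lob b₃)) / 2 := by
  have hd : b₁ - a₁ ≠ 0 ∨ b₂ - a₂ ≠ 0 := by
    by_contra! h
    exact hne (by ext <;> simp only <;> linarith [h.1, h.2])
  set V : ℝ → ℝ := fun t => lob (a₁ + t * (b₁ - a₁)) + lob (a₂ + t * (b₂ - a₂)) +
    lob (a₃ + t * (b₃ - a₃)) with hV
  set V' : ℝ → ℝ := fun t =>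
    -Real.log (2 * Real.sin (a₁ + t * (b₁ - a₁))) * (b₁ - a₁) +
    -Real.log (2 * Real.sin (a₂ + t * (b₂ - a₂))) * (b₂ - a₂) +
    -Real.log (2 * Real.sin (a₃ + t * (b₃ - a₃))) * (b₃ - a₃) with hV'
  have hderiv : ∀ t ∈ Set.Ioo (0 : ℝ) 1, HasDerivAt V (V' t) t := fun t ht =>
    ((hasDerivAt_comp_line (hasDerivAt_lob (lineMap_mem_Ioo ha₁ hb₁ ht))).add
      (hasDerivAt_comp_line (hasDerivAt_lob (lineMap_mem_Ioo ha₂ hb₂ ht)))).add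
      (hasDerivAt_comp_line (hasDerivAt_lob (lineMap_mem_Ioo ha₃ hb₃ ht)))
  have hderiv2 : ∀ t ∈ Set.Ioo (0 : ℝ) 1, ∃ m < 0, HasDerivAt V' m t := by
    intro t ht
    have h₁ := lineMap_mem_Ioo ha₁ hb₁ ht
    have h₂ := lineMap_mem_Ioo ha₂ hb₂ ht
    have h₃ := lineMap_mem_Ioo ha₃ hb₃ ht
    refine ⟨_, ?_,
      (((hasDerivAt_comp_line (hasDerivAt_log_two_mul_sin h₁)).neg.mul_const (b₁ - a₁)).add
      ((hasDerivAt_comp_line (hasDerivAt_log_two_mul_sin h₂)).neg.mul_const (b₂ - a₂))).add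
      ((hasDerivAt_comp_line (hasDerivAt_log_two_mul_sin h₃)).neg.mul_const (b₃ - a₃))⟩
    have := sum_sq_mul_cot_pos (w := b₃ - a₃) h₁ h₂ h₃
      (by linear_combination (1 - t) * hasum + t * hbsum) (by linarith) hd
    linarith
  have hanti : StrictAntiOn (deriv V) (interior (Set.Icc (0 : ℝ) 1)) := by
    rw [interior_Icc]
    have : StrictAntiOn V' (Set.Ioo (0 : ℝ) 1) := by
      refine strictAntiOn_of_deriv_neg (convex_Ioo 0 1) (fun t ht => ?_) (fun t ht => ?_)
      · obtain ⟨m, -, hm⟩ := hderiv2 t ht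
        exact hm.continuousAt.continuousWithinAt
      · obtain ⟨m, hm0, hm⟩ := hderiv2 t (interior_subset ht)
        rwa [hm.deriv]
    exact this.congr fun t ht => (hderiv t ht).deriv.symm
  have hcont : Continuous V := by
    have := continuous_lob
    fun_prop
  have hconc : StrictConcaveOn ℝ (Set.Icc (0 : ℝ) 1) V :=
    hanti.strictConcaveOn_of_deriv (convex_Icc 0 1) hcont.continuousOn
  have h := hconc.2 (Set.left_mem_Icc.2 zero_le_one) (Set.right_mem_Icc.2 zero_le_one)
    zero_ne_one (one_half_pos (α := ℝ)) one_half_pos (add_halves 1)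
  simp only [hV, smul_eq_mul, mul_zero, zero_add, mul_one, zero_mul, add_zero, one_mul,
    add_sub_cancel] at h
  rw [show (a₁ + b₁) / 2 = a₁ + 1 / 2 * (b₁ - a₁) by ring,
    show (a₂ + b₂) / 2 = a₂ + 1 / 2 * (b₂ - a₂) by ring,
    show (a₃ + b₃) / 2 = a₃ + 1 / 2 * (b₃ - a₃) by ring]
  linarith
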